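/- (Generalized Higman theorem.) For any finite set Y ⊆ A^+ of nonempty words, the quasi-order ≤_Y is a well quasi-order on A* if and only if Y is unavoidable in A*. -/

import Mathlib

/-- One insertion step: `w` is obtained from `u` by inserting a word of `Y`. -/
def InsStep {A : Type*} (Y : Set (List A)) (u w : List A) : Prop :=
  ∃ u1 u2 y : List A, y ∈ Y ∧ u = u1 ++ u2 ∧ w = u1 ++ y ++ u2

/-- The derivation quasi-order `≤_Y`: reflexive-transitive closure of `⇒_Y`. -/
def DerivLE {A : Type*} (Y : Set (List A)) : List A → List A → Prop :=
  Relation.ReflTransGen (InsStep Y)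

/-- The pure unitary language of the pure unitary grammar `(A, Y)`:
all words derivable from the empty word. -/
def unitaryLang {A : Type*} (Y : Set (List A)) : Set (List A) :=
  {w | DerivLE Y [] w}

/-- Iterated insertion: `Y^{←0} = {1}` and `Y^{←(i+1)} = Y^{←i} ← Y`. -/
def iterIns {A : Type*} (Y : Set (List A)) : ℕ → Set (List A)
  | 0 => {[]}
  | i + 1 => {w | ∃ z ∈ iterIns Y i, InsStep Y z w}

/-- `Y^{←*} = ⋃_{i ≥ 0} Y^{←i}`. -/
def iterInsStar {A : Type*} (Y : Set (List A)) : Set (List A) :=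
  ⋃ i, iterIns Y i

/-- `Y` is unavoidable in `A*`: there is `k0` such that every word of length `> k0`
has a factor in `Y`. -/
def Unavoidable {A : Type*} (Y : Set (List A)) : Prop :=
  ∃ k0 : ℕ, ∀ x : List A, k0 < x.length → ∃ y ∈ Y, y <:+: x

section GH
variable {A : Type}

theorem gh_app {Y : Set (List A)} {u u' v v' : List A} (h : DerivLE Y u u') (h' : DerivLE Y v v') :
    DerivLE Y (u ++ v) (u' ++ v') := by
  have h1 : DerivLE Y (u ++ v) (u' ++ v) := by
    refine Relation.ReflTransGen.lift (fun x => x ++ v) ?_ _ _ h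
    rintro a b ⟨u1, u2, y, hy, rfl, rfl⟩
    exact ⟨u1, u2 ++ v, y, hy, by simp, by simp⟩
  have h2 : DerivLE Y (u' ++ v) (u' ++ v') := by
    refine Relation.ReflTransGen.lift (fun x => u' ++ x) ?_ _ _ h'
    rintro a b ⟨u1, u2, y, hy, rfl, rfl⟩
    exact ⟨u' ++ u1, u2, y, hy, by simp, by simp⟩
  exact Relation.ReflTransGen.trans h1 h2

theorem gh_refl (Y : Set (List A)) (u : List A) : DerivLE Y u u := Relation.ReflTransGen.refl

theorem gh_preorder (Y : Set (List A)) : IsPreorder (List A) (DerivLE Y) where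
  refl := gh_refl Y
  trans _ _ _ := Relation.ReflTransGen.trans

/-- words `l1 a1 l2 a2 ... lm am` with each `li` in `S`. -/
def ghSand (S : Set (List A)) : List A → Set (List A)
  | [] => {[]}
  | a :: y => {w | ∃ l ∈ S, ∃ z ∈ ghSand S y, w = l ++ a :: z}

def ghL (Y : Set (List A)) : ℕ → Set (List A)
  | 0 => {[]}
  | n + 1 => {w | ∃ ls : List (List A), (∀ l ∈ ls, ∃ y ∈ Y, l ∈ ghSand (ghL Y n) y) ∧
      ls.flatten = w}

def ghD (Y : Set (List A)) : ℕ → List A → Set (List A)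
  | n, [] => ghL Y n
  | n, a :: r => {w | ∃ l ∈ ghL Y n, ∃ z ∈ ghD Y (n + 1) r, w = l ++ a :: z}

theorem ghSand_mono {S T : Set (List A)} (h : S ⊆ T) (y : List A) : ghSand S y ⊆ ghSand T y := by
  induction y with
  | nil => exact subset_rfl
  | cons a y ih =>
    rintro w ⟨l, hl, z, hz, rfl⟩
    exact ⟨l, h hl, z, ih hz, rfl⟩

theorem ghL_nil (Y : Set (List A)) (n : ℕ) : [] ∈ ghL Y n := by
  cases n with
  | zero => exact rfl
  | succ n => exact ⟨[], by simp, rfl⟩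

theorem ghL_succ (Y : Set (List A)) (n : ℕ) : ghL Y n ⊆ ghL Y (n + 1) := by
  induction n with
  | zero =>
    rintro w rfl
    exact ghL_nil Y 1
  | succ n ih =>
    rintro w ⟨ls, h, rfl⟩
    refine ⟨ls, fun l hl => ?_, rfl⟩
    obtain ⟨y, hy, hh⟩ := h l hl
    exact ⟨y, hy, ghSand_mono ih y hh⟩

theorem ghL_mono (Y : Set (List A)) : Monotone (ghL Y) := monotone_nat_of_le_succ (ghL_succ Y)

theorem ghSand_deriv {Y S : Set (List A)} (h : ∀ l ∈ S, DerivLE Y [] l) (y : List A) :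
    ∀ w ∈ ghSand S y, DerivLE Y y w := by
  induction y with
  | nil =>
    rintro w rfl
    exact gh_refl _ _
  | cons a y ih =>
    rintro w ⟨l, hl, z, hz, rfl⟩
    have := gh_app (h l hl) (gh_app (gh_refl Y [a]) (ih z hz))
    simpa using this

theorem gh_nil_le {Y S : Set (List A)} (h : ∀ l ∈ S, DerivLE Y [] l) {y : List A} (hy : y ∈ Y)
    {w : List A} (hw : w ∈ ghSand S y) : DerivLE Y [] w :=
  Relation.ReflTransGen.head ⟨[], [], y, hy, by simp, by simp⟩ (ghSand_deriv h y w hw)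

theorem ghL_nil_le (Y : Set (List A)) (n : ℕ) : ∀ l ∈ ghL Y n, DerivLE Y [] l := by
  induction n with
  | zero =>
    rintro l rfl
    exact gh_refl _ _
  | succ n ih =>
    rintro w ⟨ls, h, rfl⟩
    induction ls with
    | nil => exact gh_refl _ _
    | cons l ls ih2 =>
      obtain ⟨y, hy, hh⟩ := h l (by simp)
      have := gh_app (gh_nil_le ih hy hh) (ih2 fun l hl => h l (by simp [hl]))
      simpa using this

theorem gh_pwo_cons {Y S T : Set (List A)} (a : A) (hS : S.PartiallyWellOrderedOn (DerivLE Y))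
    (hT : T.PartiallyWellOrderedOn (DerivLE Y)) :
    {w | ∃ l ∈ S, ∃ z ∈ T, w = l ++ a :: z}.PartiallyWellOrderedOn (DerivLE Y) := by
  have := gh_preorder Y
  refine ((hS.prod hT).image_of_monotone_on (f := fun p => p.1 ++ a :: p.2)
    (r' := DerivLE Y) ?_).mono ?_
  · rintro ⟨a1, b1⟩ _ ⟨a2, b2⟩ _ ⟨h1, h2⟩
    have := gh_app h1 (gh_app (gh_refl Y [a]) h2)
    simpa using this
  · rintro w ⟨l, hl, z, hz, rfl⟩
    exact ⟨(l, z), ⟨hl, hz⟩, rfl⟩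

theorem gh_pwo_sing (Y : Set (List A)) (x : List A) :
    ({x} : Set (List A)).PartiallyWellOrderedOn (DerivLE Y) := by
  have := gh_preorder Y
  exact Set.partiallyWellOrderedOn_singleton x

theorem gh_pwo_sand {Y S : Set (List A)} (hS : S.PartiallyWellOrderedOn (DerivLE Y))
    (y : List A) : (ghSand S y).PartiallyWellOrderedOn (DerivLE Y) := by
  induction y with
  | nil => exact gh_pwo_sing Y []
  | cons a y ih => exact gh_pwo_cons a hS ih

theorem gh_pwo_biUnion {Y I : Set (List A)} (hI : I.Finite) (f : List A → Set (List A))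
    (h : ∀ i, (f i).PartiallyWellOrderedOn (DerivLE Y)) :
    {w | ∃ i ∈ I, w ∈ f i}.PartiallyWellOrderedOn (DerivLE Y) := by
  have := gh_preorder Y
  refine ((Finset.partiallyWellOrderedOn_bUnion (r := DerivLE Y) hI.toFinset (f := f)).2
    fun i _ => h i).mono ?_
  rintro w ⟨i, hi, hw⟩
  simp only [Set.mem_iUnion]
  exact ⟨i, by simpa using hi, hw⟩

theorem gh_sublist {Y : Set (List A)} {l1 l2 : List (List A)}
    (h : List.SublistForall₂ (DerivLE Y) l1 l2) :
    (∀ l ∈ l2, DerivLE Y [] l) → DerivLE Y l1.flatten l2.flatten := by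
  induction h with
  | @nil l =>
    intro h
    induction l with
    | nil => exact gh_refl _ _
    | cons a l ih =>
      have := gh_app (h a (by simp)) (ih fun x hx => h x (by simp [hx]))
      simpa using this
  | cons h1 _ ih =>
    intro h
    have := gh_app h1 (ih fun x hx => h x (by simp [hx]))
    simpa using this
  | cons_right _ ih =>
    intro h
    have := gh_app (h _ (List.mem_cons_self)) (ih fun x hx => h x (by simp [hx]))
    simpa using this

theorem ghL_pwo {Y : Set (List A)} (hY : Y.Finite) (n : ℕ) :
    (ghL Y n).PartiallyWellOrderedOn (DerivLE Y) := by
  have := gh_preorder Y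
  induction n with
  | zero => exact gh_pwo_sing Y []
  | succ n ih =>
    have h1 := gh_pwo_biUnion hY (fun y => ghSand (ghL Y n) y) (fun y => gh_pwo_sand ih y)
    have h2 := h1.partiallyWellOrderedOn_sublistForall₂ (DerivLE Y)
    refine (h2.image_of_monotone_on (f := List.flatten) (r' := DerivLE Y) ?_).mono ?_
    · intro a _ b hb hab
      refine gh_sublist hab fun l hl => ?_
      obtain ⟨y, hy, hh⟩ := hb l hl
      exact gh_nil_le (ghL_nil_le Y n) hy hh
    · rintro w ⟨ls, h, rfl⟩
      exact ⟨ls, h, rfl⟩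

theorem ghD_pwo {Y : Set (List A)} (hY : Y.Finite) (r : List A) : ∀ n : ℕ,
    (ghD Y n r).PartiallyWellOrderedOn (DerivLE Y) := by
  induction r with
  | nil => exact fun n => ghL_pwo hY n
  | cons a r ih => exact fun n => gh_pwo_cons a (ghL_pwo hY n) (ih (n + 1))

theorem ghD_split (Y : Set (List A)) (k : ℕ) (r : List A) (y : List A) :
    ∀ n, n + y.length = k + 1 → ∀ w ∈ ghD Y n (y ++ r),
      ∃ z ∈ ghSand (ghL Y k) y, ∃ w' ∈ ghD Y (k + 1) r, w = z ++ w' := by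
  induction y with
  | nil =>
    intro n hn w hw
    simp at hn
    subst hn
    exact ⟨[], rfl, w, hw, rfl⟩
  | cons a y ih =>
    rintro n hn w ⟨l, hl, v, hv, rfl⟩
    simp at hn
    obtain ⟨z, hz, w', hw', rfl⟩ := ih (n + 1) (by omega) v hv
    exact ⟨l ++ a :: z, ⟨l, ghL_mono Y (by omega) hl, z, hz, rfl⟩, w', hw', by simp⟩

theorem ghD_prepend {Y : Set (List A)} {k : ℕ} {r y z w : List A} (hy : y ∈ Y)
    (hz : z ∈ ghSand (ghL Y k) y) (hw : w ∈ ghD Y (k + 1) r) : z ++ w ∈ ghD Y (k + 1) r := by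
  have key : ∀ l ∈ ghL Y (k + 1), z ++ l ∈ ghL Y (k + 1) := by
    rintro l ⟨ls, h, rfl⟩
    refine ⟨z :: ls, ?_, by simp⟩
    intro l hl
    rcases List.mem_cons.1 hl with rfl | hl
    · exact ⟨y, hy, hz⟩
    · exact h l hl
  cases r with
  | nil => exact key w hw
  | cons a r =>
    obtain ⟨l, hl, v, hv, rfl⟩ := hw
    exact ⟨z ++ l, key l hl, v, hv, by simp⟩

theorem gh_decomp {Y : Set (List A)} (hne : ∀ y ∈ Y, y ≠ []) {k0 : ℕ}
    (hk : ∀ x : List A, k0 < x.length → ∃ y ∈ Y, y <:+: x) (w : List A) :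
    ∃ r : List A, (∀ y ∈ Y, ¬ y <:+: r) ∧ ∃ n, n + r.length = k0 + 1 ∧ w ∈ ghD Y n r := by
  induction w with
  | nil =>
    refine ⟨[], ?_, k0 + 1, by simp, ghL_nil Y _⟩
    intro y hy h
    exact hne y hy (by simpa using h)
  | cons a w ih =>
    obtain ⟨r, hr, n, hn, hw⟩ := ih
    have hlen : r.length ≤ k0 := by
      by_contra hc
      obtain ⟨y, hy, h⟩ := hk r (by omega)
      exact hr y hy h
    obtain ⟨m, rfl⟩ : ∃ m, n = m + 1 := ⟨n - 1, by omega⟩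
    have hD : a :: w ∈ ghD Y m (a :: r) := ⟨[], ghL_nil Y m, w, hw, rfl⟩
    by_cases hp : ∃ y ∈ Y, y <+: a :: r
    · obtain ⟨y, hy, r', hr'⟩ := hp
      cases y with
      | nil => exact absurd rfl (hne _ hy)
      | cons b y =>
        have hl := congrArg List.length hr'
        simp at hl
        obtain ⟨rfl, hrr⟩ : b = a ∧ y ++ r' = r := by simpa using hr'
        rw [← hr'] at hD
        obtain ⟨z, hz, w', hw', he⟩ := ghD_split Y (m + y.length) r' (b :: y) m
          (by simp; omega) _ hD
        refine ⟨r', ?_, m + y.length + 1, by omega, ?_⟩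
        · intro y' hy' h
          exact hr y' hy' (h.trans ⟨y, [], by simpa using hrr⟩)
        · rw [he]
          exact ghD_prepend hy hz hw'
    · refine ⟨a :: r, ?_, m, by simp; omega, hD⟩
      intro y hy h
      rcases List.infix_cons_iff.1 h with h | h
      · exact hp ⟨y, hy, h⟩
      · exact hr y hy h

theorem gh_len {Y : Set (List A)} {u v : List A} (h : DerivLE Y u v) :
    u = v ∨ ∃ y ∈ Y, y <:+: v := by
  rcases Relation.ReflTransGen.cases_tail h with h | ⟨c, _, u1, u2, y, hy, _, rfl⟩
  · exact Or.inl h.symm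
  · exact Or.inr ⟨y, hy, u1, u2, rfl⟩

end GH

/-- Generalized Higman theorem: for a finite set `Y ⊆ A^+` of nonempty words, the
quasi-order `≤_Y` is a well quasi-order on `A*` iff `Y` is unavoidable in `A*`. -/
theorem stmt14 {A : Type} [Fintype A] (Y : Set (List A))
    (hfin : Y.Finite) (hne : ∀ y ∈ Y, y ≠ []) :
    (∀ f : ℕ → List A, ∃ i j : ℕ, i < j ∧ DerivLE Y (f i) (f j)) ↔ Unavoidable Y := by
  constructor
  · intro h
    by_contra hc
    unfold Unavoidable at hc
    push Not at hc
    choose g hg1 hg2 using hc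
    -- lengths strictly increase along the iterates
    let F : ℕ → List A := fun n => Nat.rec (g 0) (fun _ x => g x.length) n
    have hF : StrictMono fun n => (F n).length := strictMono_nat_of_lt_succ fun n => hg1 _
    have hF2 : ∀ n, ∀ y ∈ Y, ¬ y <:+: F n := by
      intro n
      cases n with
      | zero => exact hg2 0
      | succ n => exact hg2 _
    obtain ⟨i, j, hij, hd⟩ := h F
    rcases gh_len hd with he | ⟨y, hy, hh⟩
    · have := hF hij
      simp only [he] at this
      omega
    · exact hF2 j y hy hh
  · rintro ⟨k0, hk⟩ f
    have hfinr : {r : List A | r.length ≤ k0}.Finite := List.finite_length_le A k0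
    have hp := gh_pwo_biUnion (Y := Y) hfinr (fun r => ghD Y (k0 + 1 - r.length) r)
      (fun r => ghD_pwo hfin r _)
    refine hp.exists_lt (f := f) fun n => ?_
    obtain ⟨r, hr, m, hm, hw⟩ := gh_decomp hne hk (f n)
    have hlen : r.length ≤ k0 := by
      by_contra hc
      obtain ⟨y, hy, h⟩ := hk r (by omega)
      exact hr y hy h
    refine ⟨r, hlen, ?_⟩
    have : k0 + 1 - r.length = m := by omega
    simpa only [this] using hw
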